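/- arXiv:1911.07080 — 6 statements merged into one kernel-verified Lean document; each statement's English description precedes it below -/
import Mathlib

section
/- If the linear program (P): minimize c·x subject to Ax = b, x ≥ 0, has a finite optimal value, then its optimal value equals the optimal value of the dual linear program (D): maximize b·π subject to Aᵀπ ≤ c, and moreover both (P) and (D) possess optimal solutions (the infimum in (P) and the supremum in (D) are attained). -/
open Matrix

theorem farkas_aux {V ι : Type*} [AddCommGroup V] [Module ℝ V] [DecidableEq ι] (s : Finset ι) :
    ∀ (a : ι → V →ₗ[ℝ] ℝ) (φ : V →ₗ[ℝ] ℝ),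
      (∀ x, (∀ i ∈ s, a i x ≤ 0) → φ x ≤ 0) →
      ∃ l : ι → ℝ, (∀ i, 0 ≤ l i) ∧ ∀ x, φ x = ∑ i ∈ s, l i * a i x := by
  induction s using Finset.induction_on with
  | empty =>
    intro a φ h
    refine ⟨0, fun i => le_rfl, fun x => ?_⟩
    have h1 := h x (by simp)
    have h2 := h (-x) (by simp)
    simp at h2 ⊢
    linarith
  | insert j s hj ih =>
    intro a φ h
    by_cases hc : ∀ x, (∀ i ∈ s, a i x ≤ 0) → φ x ≤ 0
    · obtain ⟨l, hl, hs⟩ := ih a φ hc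
      refine ⟨fun i => if i = j then 0 else l i, fun i => ?_, fun x => ?_⟩
      · dsimp only
        split_ifs
        exacts [le_rfl, hl i]
      · rw [Finset.sum_insert hj, hs x]
        simp only [if_true, zero_mul, zero_add]
        refine Finset.sum_congr rfl fun i hi => ?_
        rw [if_neg]
        rintro rfl
        exact hj hi
    · push Not at hc
      obtain ⟨y, hy, hφ⟩ := hc
      have hjy : 0 < a j y := by
        by_contra hn
        push Not at hn
        have := h y (by
          intro i hi
          rcases Finset.mem_insert.1 hi with rfl | hi
          exacts [hn, hy i hi])
        linarith
      set r := a j y with hr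
      obtain ⟨l, hl, hs⟩ := ih (fun i => a i - (a i y / r) • a j) (φ - (φ y / r) • a j) (by
        intro x hx
        have := h (x - (a j x / r) • y) (by
          intro i hi
          rcases Finset.mem_insert.1 hi with rfl | hi
          · simp only [map_sub, map_smul, smul_eq_mul, ← hr]
            rw [div_mul_cancel₀ _ hjy.ne']
            simp
          · have := hx i hi
            simp only [LinearMap.sub_apply, LinearMap.smul_apply, map_sub, map_smul, smul_eq_mul] at this ⊢
            calc _ = _ := by ring
              _ ≤ 0 := this)
        simp only [LinearMap.sub_apply, LinearMap.smul_apply, map_sub, map_smul, smul_eq_mul] at this ⊢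
        calc _ = _ := by ring
          _ ≤ 0 := this)
      refine ⟨fun i => if i = j then φ y / r - ∑ k ∈ s, l k * (a k y / r) else l i,
        fun i => ?_, fun x => ?_⟩
      · dsimp only
        split_ifs
        · have : ∑ k ∈ s, l k * (a k y / r) ≤ 0 := Finset.sum_nonpos fun k hk =>
            mul_nonpos_of_nonneg_of_nonpos (hl k) (div_nonpos_of_nonpos_of_nonneg (hy k hk) hjy.le)
          have := div_pos hφ hjy
          linarith
        · exact hl i
      · rw [Finset.sum_insert hj]
        have e : ∑ i ∈ s, (if i = j then φ y / r - ∑ k ∈ s, l k * (a k y / r) else l i) * a i x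
            = ∑ i ∈ s, l i * a i x := by
          refine Finset.sum_congr rfl fun i hi => ?_
          rw [if_neg]
          rintro rfl
          exact hj hi
        rw [e]
        have := hs x
        simp only [LinearMap.sub_apply, LinearMap.smul_apply, smul_eq_mul, mul_sub,
          Finset.sum_sub_distrib] at this
        have e2 : ∑ i ∈ s, l i * (a i y / r * a j x) = (∑ i ∈ s, l i * (a i y / r)) * a j x := by
          rw [Finset.sum_mul]
          exact Finset.sum_congr rfl fun i _ => by ring
        rw [e2] at this
        simp only [if_true, sub_mul]
        linarith

theorem lp_primal_aux {m n : ℕ}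
    (A : Matrix (Fin m) (Fin n) ℝ) (b : Fin m → ℝ) (c : Fin n → ℝ) (v : ℝ)
    (hv : ∀ x : Fin n → ℝ, A.mulVec x = b → 0 ≤ x → v ≤ c ⬝ᵥ x)
    (hv' : ∀ w, v < w → ∃ x : Fin n → ℝ, A.mulVec x = b ∧ 0 ≤ x ∧ c ⬝ᵥ x < w) :
    ∃ x : Fin n → ℝ, A.mulVec x = b ∧ 0 ≤ x ∧ v = c ⬝ᵥ x := by
  let D (k : ℕ) (u : Fin k → ℝ) : (Fin k → ℝ) →ₗ[ℝ] ℝ := dotProductBilin ℝ ℝ u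
  have hD : ∀ k (u w : Fin k → ℝ), D k u w = u ⬝ᵥ w := fun _ _ _ => rfl
  obtain ⟨l, hl, h⟩ := farkas_aux (V := (Fin m → ℝ) × ℝ) (Finset.univ : Finset (Fin n))
    (fun j => (D m (fun i => A i j)).comp (LinearMap.fst ℝ _ _) + c j • LinearMap.snd ℝ _ _)
    ((D m b).comp (LinearMap.fst ℝ _ _) + v • LinearMap.snd ℝ _ _) (by
      rintro ⟨p, t⟩ hp
      simp only [Finset.mem_univ, true_imp_iff, LinearMap.add_apply, LinearMap.comp_apply,
        LinearMap.fst_apply, LinearMap.snd_apply, LinearMap.smul_apply, smul_eq_mul, hD] at hp ⊢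
      have key : ∀ x : Fin n → ℝ, A.mulVec x = b → 0 ≤ x → b ⬝ᵥ p + (c ⬝ᵥ x) * t ≤ 0 := by
        intro x hx h0
        have : b ⬝ᵥ p + (c ⬝ᵥ x) * t = ∑ j, x j * ((fun i => A i j) ⬝ᵥ p + c j * t) := by
          rw [← hx, dotProduct_comm, dotProduct_mulVec]
          simp only [dotProduct, vecMul, Finset.sum_mul, ← Finset.sum_add_distrib]
          refine Finset.sum_congr rfl fun j _ => ?_
          rw [mul_add, Finset.mul_sum]
          congr 1
          · exact Finset.sum_congr rfl fun i _ => by ring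
          · ring
        rw [this]
        exact Finset.sum_nonpos fun j _ => mul_nonpos_of_nonneg_of_nonpos (h0 j) (hp j)
      by_contra hpos
      push Not at hpos
      rcases le_or_gt 0 t with ht | ht
      · obtain ⟨x, hx, h0, _⟩ := hv' (v + 1) (by linarith)
        have := key x hx h0
        have := mul_le_mul_of_nonneg_right (hv x hx h0) ht
        linarith
      · obtain ⟨x, hx, h0, hlt⟩ := hv' (b ⬝ᵥ p / (-t)) (by
          rw [lt_div_iff₀ (by linarith)]; linarith)
        have := key x hx h0
        rw [lt_div_iff₀ (by linarith)] at hlt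
        linarith)
  simp only [LinearMap.add_apply, LinearMap.comp_apply,
        LinearMap.fst_apply, LinearMap.snd_apply, LinearMap.smul_apply, smul_eq_mul, hD] at h
  refine ⟨l, ?_, hl, ?_⟩
  · ext i
    have := h (Pi.single i 1, 0)
    simp at this
    rw [this]
    simp [mulVec, dotProduct, mul_comm]
  · have := h (0, 1)
    simp at this
    rw [this]
    simp [dotProduct, mul_comm]

theorem lp_dual_aux {m n : ℕ}
    (A : Matrix (Fin m) (Fin n) ℝ) (b : Fin m → ℝ) (c : Fin n → ℝ) (v : ℝ)
    (hfeas : ∃ x : Fin n → ℝ, A.mulVec x = b ∧ 0 ≤ x)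
    (hv : ∀ x : Fin n → ℝ, A.mulVec x = b → 0 ≤ x → v ≤ c ⬝ᵥ x) :
    ∃ p : Fin m → ℝ, Aᵀ.mulVec p ≤ c ∧ v ≤ b ⬝ᵥ p := by
  let D (k : ℕ) (u : Fin k → ℝ) : (Fin k → ℝ) →ₗ[ℝ] ℝ := dotProductBilin ℝ ℝ u
  have hD : ∀ k (u w : Fin k → ℝ), D k u w = u ⬝ᵥ w := fun _ _ _ => rfl
  let R (i : Fin m) : (Fin n → ℝ) × ℝ →ₗ[ℝ] ℝ :=
    (D n (A i)).comp (LinearMap.fst ℝ _ _) - b i • LinearMap.snd ℝ _ _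
  have hR : ∀ i x t, R i (x, t) = A i ⬝ᵥ x - b i * t := fun _ _ _ => rfl
  let F : (Fin n ⊕ Unit) ⊕ (Fin m ⊕ Fin m) → (Fin n → ℝ) × ℝ →ₗ[ℝ] ℝ :=
    Sum.elim (Sum.elim (fun j => -((LinearMap.proj j).comp (LinearMap.fst ℝ _ _)))
      (fun _ => -LinearMap.snd ℝ _ _)) (Sum.elim (fun i => R i) (fun i => - R i))
  obtain ⟨l, hl, h⟩ := farkas_aux Finset.univ F
    (v • LinearMap.snd ℝ _ _ - (D n c).comp (LinearMap.fst ℝ _ _)) (by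
      rintro ⟨x, t⟩ hp
      simp only [Finset.mem_univ, true_imp_iff, LinearMap.sub_apply, LinearMap.comp_apply,
        LinearMap.fst_apply, LinearMap.snd_apply, LinearMap.smul_apply, smul_eq_mul, hD] at hp ⊢
      have h0 : 0 ≤ x := fun j => by simpa [F] using hp (.inl (.inl j))
      have ht : 0 ≤ t := by simpa [F] using hp (.inl (.inr ()))
      have hA : A *ᵥ x = t • b := by
        ext i
        have h1 := hp (.inr (.inl i))
        have h2 := hp (.inr (.inr i))
        simp only [F, Sum.elim_inr, Sum.elim_inl, LinearMap.neg_apply, hR] at h1 h2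
        simp only [mulVec, Pi.smul_apply, smul_eq_mul]
        linarith
      rcases ht.eq_or_lt with rfl | ht
      · obtain ⟨y, hy, hy0⟩ := hfeas
        by_contra hn
        push Not at hn
        have hneg : 0 < -(c ⬝ᵥ x) := by linarith
        obtain ⟨k, hk⟩ := exists_nat_gt ((c ⬝ᵥ y - v) / (-(c ⬝ᵥ x)))
        rw [div_lt_iff₀ hneg] at hk
        have := hv (y + (k : ℝ) • x) (by rw [mulVec_add, mulVec_smul, hA, hy]; simp)
          (add_nonneg hy0 (smul_nonneg k.cast_nonneg h0))
        rw [dotProduct_add, dotProduct_smul, smul_eq_mul] at this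
        linarith
      · have := hv (t⁻¹ • x) (by rw [mulVec_smul, hA, smul_smul, inv_mul_cancel₀ ht.ne', one_smul])
          (smul_nonneg (inv_nonneg.2 ht.le) h0)
        rw [dotProduct_smul, smul_eq_mul, inv_mul_eq_div, le_div_iff₀ ht] at this
        linarith)
  simp only [LinearMap.sub_apply, LinearMap.comp_apply, Fintype.sum_sum_type, F, Sum.elim_inl,
    Sum.elim_inr, LinearMap.neg_apply, LinearMap.proj_apply,
        LinearMap.fst_apply, LinearMap.snd_apply, LinearMap.smul_apply, smul_eq_mul, hD] at h
  refine ⟨fun i => l (.inr (.inr i)) - l (.inr (.inl i)), fun j => ?_, ?_⟩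
  · have := h (Pi.single j 1, 0)
    simp [hR, Pi.single_apply] at this
    have h0 := hl (.inl (.inl j))
    simp only [mulVec, dotProduct, transpose_apply, mul_sub, Finset.sum_sub_distrib]
    simp only [mul_comm (A _ _)]
    linarith
  · have := h (0, 1)
    simp [hR] at this
    have h0 := hl (.inl (.inr ()))
    simp only [dotProduct, mul_sub, Finset.sum_sub_distrib]
    simp only [mul_comm (b _)]
    linarith

/-- Strong duality for linear programs: if the primal problem
`min c·x s.t. Ax = b, x ≥ 0` has a finite optimal value (its feasible set is
nonempty and the objective is bounded below on it), then the primal and dual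
optimal values coincide and both are attained. -/
theorem lp_strong_duality {m n : ℕ}
    (A : Matrix (Fin m) (Fin n) ℝ) (b : Fin m → ℝ) (c : Fin n → ℝ)
    (hfeas : ∃ x : Fin n → ℝ, A.mulVec x = b ∧ 0 ≤ x)
    (hbdd : BddBelow {v : ℝ | ∃ x : Fin n → ℝ, A.mulVec x = b ∧ 0 ≤ x ∧ v = c ⬝ᵥ x}) :
    ∃ v : ℝ,
      IsLeast {v : ℝ | ∃ x : Fin n → ℝ, A.mulVec x = b ∧ 0 ≤ x ∧ v = c ⬝ᵥ x} v ∧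
      IsGreatest {w : ℝ | ∃ π : Fin m → ℝ, Aᵀ.mulVec π ≤ c ∧ w = b ⬝ᵥ π} v := by
  have hne : {v : ℝ | ∃ x : Fin n → ℝ, A.mulVec x = b ∧ 0 ≤ x ∧ v = c ⬝ᵥ x}.Nonempty := by
    obtain ⟨x, hx, h0⟩ := hfeas
    exact ⟨_, x, hx, h0, rfl⟩
  have hg := isGLB_csInf hne hbdd
  generalize sInf {v : ℝ | ∃ x : Fin n → ℝ, A.mulVec x = b ∧ 0 ≤ x ∧ v = c ⬝ᵥ x} = v at hg
  have hv : ∀ x : Fin n → ℝ, A.mulVec x = b → 0 ≤ x → v ≤ c ⬝ᵥ x :=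
    fun x hx h0 => hg.1 ⟨x, hx, h0, rfl⟩
  obtain ⟨x, hx, h0, hxv⟩ := lp_primal_aux A b c v hv (by
    intro w hw
    obtain ⟨_, ⟨x, hx, h0, rfl⟩, _, hlt⟩ := hg.exists_between hw
    exact ⟨x, hx, h0, hlt⟩)
  obtain ⟨p, hp, hpv⟩ := lp_dual_aux A b c v hfeas hv
  have weak : ∀ q : Fin m → ℝ, Aᵀ.mulVec q ≤ c → b ⬝ᵥ q ≤ v := by
    intro q hq
    rw [hxv, ← hx, dotProduct_comm, dotProduct_mulVec, ← mulVec_transpose]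
    exact dotProduct_le_dotProduct_of_nonneg_right hq h0
  refine ⟨v, ⟨⟨x, hx, h0, hxv⟩, hg.1⟩, ⟨p, hp, le_antisymm hpv (weak p hp)⟩, ?_⟩
  rintro _ ⟨q, hq, rfl⟩
  exact weak q hq
end

section
/- Suppose the entries of c(θ), b(θ) and A(θ) are continuously differentiable functions of θ, and that at θ = θ̄ the optimal value ϑ(θ̄) is finite and both optimal solution sets 𝔖(θ̄) and 𝔇(θ̄) are nonempty and bounded. Then for every direction h ∈ ℝᵏ the directional derivative ϑ'(θ̄,h) := lim_{t→0⁺}(ϑ(θ̄+th) − ϑ(θ̄))/t exists and ϑ'(θ̄,h) = max_{π ∈ 𝔇(θ̄)} min_{x ∈ 𝔖(θ̄)} h·∇_θ L(x,π,θ̄). -/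
open Matrix Filter Topology

/-- Optimal value of the parametric primal linear program
`ϑ(θ) = inf { c(θ)·x : A(θ)x = b(θ), x ≥ 0 }` (real infimum). -/
noncomputable def parLPValue {k m n : ℕ}
    (A : (Fin k → ℝ) → Matrix (Fin m) (Fin n) ℝ)
    (b : (Fin k → ℝ) → Fin m → ℝ) (c : (Fin k → ℝ) → Fin n → ℝ)
    (θ : Fin k → ℝ) : ℝ :=
  sInf {v : ℝ | ∃ x : Fin n → ℝ, (A θ).mulVec x = b θ ∧ 0 ≤ x ∧ v = c θ ⬝ᵥ x}

/-- The Lagrangian `L(x,π,θ) = c(θ)·x + π·(b(θ) − A(θ)x)`. -/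
noncomputable def parLPLagrangian {k m n : ℕ}
    (A : (Fin k → ℝ) → Matrix (Fin m) (Fin n) ℝ)
    (b : (Fin k → ℝ) → Fin m → ℝ) (c : (Fin k → ℝ) → Fin n → ℝ)
    (x : Fin n → ℝ) (π : Fin m → ℝ) (θ : Fin k → ℝ) : ℝ :=
  c θ ⬝ᵥ x + π ⬝ᵥ (b θ - (A θ).mulVec x)


noncomputable def lpF {m n : ℕ} (p : Fin n → ℝ) (q : Fin m → ℝ) (M : Matrix (Fin m) (Fin n) ℝ)
    (x : Fin n → ℝ) (y : Fin m → ℝ) : ℝ :=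
  p ⬝ᵥ x + y ⬝ᵥ (q - M.mulVec x)

lemma lpF_eq {m n : ℕ} (p : Fin n → ℝ) (q : Fin m → ℝ) (M : Matrix (Fin m) (Fin n) ℝ)
    (x : Fin n → ℝ) (y : Fin m → ℝ) :
    lpF p q M x y = q ⬝ᵥ y + (p - Mᵀ.mulVec y) ⬝ᵥ x := by
  have h : y ⬝ᵥ M.mulVec x = Mᵀ.mulVec y ⬝ᵥ x := by
    rw [Matrix.dotProduct_mulVec, Matrix.mulVec_transpose]
  simp only [lpF, dotProduct_sub, sub_dotProduct, h, dotProduct_comm y q]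
  ring

lemma lpF_feas {m n : ℕ} {p : Fin n → ℝ} {q : Fin m → ℝ} {M : Matrix (Fin m) (Fin n) ℝ}
    {x : Fin n → ℝ} (y : Fin m → ℝ) (h : M.mulVec x = q) : lpF p q M x y = p ⬝ᵥ x := by
  simp [lpF, h]

lemma dot_nonneg' {n : ℕ} {u v : Fin n → ℝ} (hu : 0 ≤ u) (hv : 0 ≤ v) : 0 ≤ u ⬝ᵥ v :=
  Finset.sum_nonneg fun i _ => mul_nonneg (hu i) (hv i)

lemma lpF_dual {m n : ℕ} {p : Fin n → ℝ} {q : Fin m → ℝ} {M : Matrix (Fin m) (Fin n) ℝ}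
    {x : Fin n → ℝ} {y : Fin m → ℝ} (hx : 0 ≤ x) (h : Mᵀ.mulVec y ≤ p) :
    q ⬝ᵥ y ≤ lpF p q M x y := by
  rw [lpF_eq]
  have := dot_nonneg' (sub_nonneg.2 h) hx
  linarith

lemma lpF_tendsto {ι : Type*} {l : Filter ι} {m n : ℕ}
    {p : ι → Fin n → ℝ} {q : ι → Fin m → ℝ} {M : ι → Matrix (Fin m) (Fin n) ℝ}
    {x : ι → Fin n → ℝ} {y : ι → Fin m → ℝ} {p0 q0 M0 x0 y0}
    (hp : Tendsto p l (𝓝 p0)) (hq : Tendsto q l (𝓝 q0)) (hM : Tendsto M l (𝓝 M0))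
    (hx : Tendsto x l (𝓝 x0)) (hy : Tendsto y l (𝓝 y0)) :
    Tendsto (fun t => lpF (p t) (q t) (M t) (x t) (y t)) l (𝓝 (lpF p0 q0 M0 x0 y0)) := by
  have hc : Continuous (fun z : (Fin n → ℝ) × (Fin m → ℝ) × (Matrix (Fin m) (Fin n) ℝ) ×
      (Fin n → ℝ) × (Fin m → ℝ) => lpF z.1 z.2.1 z.2.2.1 z.2.2.2.1 z.2.2.2.2) := by
    unfold lpF
    fun_prop
  exact (hc.tendsto (p0, q0, M0, x0, y0)).comp
    (hp.prodMk_nhds (hq.prodMk_nhds (hM.prodMk_nhds (hx.prodMk_nhds hy))))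

lemma lpF_quot {m n : ℕ} (p p' : Fin n → ℝ) (q q' : Fin m → ℝ)
    (M M' : Matrix (Fin m) (Fin n) ℝ) (x : Fin n → ℝ) (y : Fin m → ℝ) (t : ℝ) :
    lpF (t⁻¹ • (p' - p)) (t⁻¹ • (q' - q)) (t⁻¹ • (M' - M)) x y
      = t⁻¹ * (lpF p' q' M' x y - lpF p q M x y) := by
  simp only [lpF, Matrix.smul_mulVec, Matrix.sub_mulVec, smul_dotProduct, dotProduct_sub,
    dotProduct_smul, sub_dotProduct, smul_eq_mul]
  ring

lemma lpF_saddle {m n : ℕ} (p : Fin n → ℝ) (q : Fin m → ℝ) (M : Matrix (Fin m) (Fin n) ℝ)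
    {X : Set (Fin n → ℝ)} {Y : Set (Fin m → ℝ)} (nX : X.Nonempty) (cX : Convex ℝ X)
    (kX : IsCompact X) (nY : Y.Nonempty) (cY : Convex ℝ Y) (kY : IsCompact Y) :
    ∃ a ∈ X, ∃ b ∈ Y, ∀ x ∈ X, ∀ y ∈ Y, lpF p q M a y ≤ lpF p q M x b := by
  refine Sion.exists_isSaddlePointOn (f := lpF p q M) nX cX kX ?_ ?_ cY nY kY ?_ ?_
  · intro y _
    have : Continuous (fun x => lpF p q M x y) := by unfold lpF; fun_prop
    exact this.lowerSemicontinuous.lowerSemicontinuousOn _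
  · intro y _
    apply ConvexOn.quasiconvexOn
    refine ⟨cX, fun u _ v _ s t _ _ hst => le_of_eq ?_⟩
    simp only [lpF_eq, dotProduct_add, dotProduct_smul, smul_eq_mul]
    linear_combination (-(q ⬝ᵥ y)) * hst
  · intro x _
    have : Continuous (fun y => lpF p q M x y) := by unfold lpF; fun_prop
    exact this.upperSemicontinuous.upperSemicontinuousOn _
  · intro x _
    apply ConcaveOn.quasiconcaveOn
    refine ⟨cY, fun u _ v _ s t _ _ hst => le_of_eq ?_⟩
    simp only [lpF, add_dotProduct, smul_dotProduct, smul_eq_mul]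
    linear_combination (p ⬝ᵥ x) * hst

lemma lpF_K1 {m n : ℕ} {p : Fin n → ℝ} {q : Fin m → ℝ} {M : Matrix (Fin m) (Fin n) ℝ}
    {x : Fin n → ℝ} {y1 : Fin m → ℝ} {R : ℝ} (hy : ‖y1‖ < R)
    (h : ∀ y, ‖y‖ ≤ R → lpF p q M x y ≤ lpF p q M x y1) : M.mulVec x = q := by
  set r := q - M.mulVec x with hr
  have hpos : 0 < 1 + ‖r‖ := by positivity
  set e := (R - ‖y1‖) / (1 + ‖r‖) with he
  have hepos : 0 < e := div_pos (by linarith) hpos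
  have hb : ‖y1 + e • r‖ ≤ R := by
    have h1 : ‖e • r‖ = e * ‖r‖ := by rw [norm_smul, Real.norm_of_nonneg hepos.le]
    have h2 : e * (1 + ‖r‖) = R - ‖y1‖ := by rw [he]; field_simp
    have := norm_add_le y1 (e • r)
    nlinarith
  have := h _ hb
  simp only [lpF, ← hr, add_dotProduct, smul_dotProduct, smul_eq_mul] at this
  have h0 : r ⬝ᵥ r = 0 := by
    apply le_antisymm
    · by_contra hc
      have := mul_pos hepos (not_le.1 hc)
      linarith
    · exact Finset.sum_nonneg fun i _ => mul_self_nonneg _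
  rw [dotProduct_self_eq_zero] at h0
  exact (sub_eq_zero.1 (hr ▸ h0)).symm

lemma lpF_K2 {m n : ℕ} {p : Fin n → ℝ} {q : Fin m → ℝ} {M : Matrix (Fin m) (Fin n) ℝ}
    {x1 : Fin n → ℝ} {y : Fin m → ℝ} {R : ℝ} (hx0 : 0 ≤ x1) (hx : ‖x1‖ < R)
    (h : ∀ x, 0 ≤ x → ‖x‖ ≤ R → lpF p q M x1 y ≤ lpF p q M x y) :
    Mᵀ.mulVec y ≤ p ∧ q ⬝ᵥ y = lpF p q M x1 y := by
  have h1 : Mᵀ.mulVec y ≤ p := by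
    intro j
    have hs : 0 < R - ‖x1‖ := by linarith
    have hn : (0 : Fin n → ℝ) ≤ Pi.single j (R - ‖x1‖) := by
      rw [Pi.single_nonneg]; exact hs.le
    have := h (x1 + Pi.single j (R - ‖x1‖)) (add_nonneg hx0 hn) (by
      refine (norm_add_le _ _).trans ?_
      rw [Pi.norm_single, Real.norm_of_nonneg hs.le]
      linarith)
    simp only [lpF_eq, dotProduct_add, dotProduct_single] at this
    have h3 : 0 ≤ (p - Mᵀ.mulVec y) j * (R - ‖x1‖) := by linarith
    have := nonneg_of_mul_nonneg_left h3 hs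
    simpa using this
  refine ⟨h1, le_antisymm (lpF_dual hx0 h1) ?_⟩
  have := h 0 le_rfl (by simpa using (norm_nonneg _).trans hx.le)
  refine this.trans (le_of_eq ?_)
  simp [lpF_eq]

lemma lp_value {m n : ℕ} {p : Fin n → ℝ} {q : Fin m → ℝ} {M : Matrix (Fin m) (Fin n) ℝ}
    {x : Fin n → ℝ} {y : Fin m → ℝ} (hx : 0 ≤ x) (h : M.mulVec x = q) (hy : Mᵀ.mulVec y ≤ p)
    (he : q ⬝ᵥ y = p ⬝ᵥ x) :
    sInf {v : ℝ | ∃ x : Fin n → ℝ, M.mulVec x = q ∧ 0 ≤ x ∧ v = p ⬝ᵥ x} = p ⬝ᵥ x := by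
  apply IsLeast.csInf_eq
  refine ⟨⟨x, h, hx, rfl⟩, ?_⟩
  rintro v ⟨z, hz, hz0, rfl⟩
  rw [← he, ← lpF_feas (p := p) y hz]
  exact lpF_dual hz0 hy

lemma quot_tendsto {k : ℕ} {g : (Fin k → ℝ) → ℝ} {a : Fin k → ℝ} (hg : DifferentiableAt ℝ g a)
    (h : Fin k → ℝ) :
    Tendsto (fun t : ℝ => t⁻¹ * (g (a + t • h) - g a)) (𝓝[>] 0) (𝓝 (fderiv ℝ g a h)) :=
  (hg.hasFDerivAt.hasLineDerivAt h).tendsto_slope_zero_right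

/-- Directional differentiability of the optimal value of a parametric linear
program: under continuous differentiability of the data, finiteness of the
optimal value at `θ̄` and nonemptiness and boundedness of the primal and dual
solution sets at `θ̄`, for every direction `h` the directional derivative
`ϑ'(θ̄,h)` exists and equals
`max_{π ∈ 𝔇(θ̄)} min_{x ∈ 𝔖(θ̄)} h·∇_θ L(x,π,θ̄)`. -/
theorem parametric_lp_directional_derivative {k m n : ℕ}
    (A : (Fin k → ℝ) → Matrix (Fin m) (Fin n) ℝ)
    (b : (Fin k → ℝ) → Fin m → ℝ) (c : (Fin k → ℝ) → Fin n → ℝ)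
    (hA : ∀ i j, ContDiff ℝ 1 (fun θ => A θ i j))
    (hb : ∀ i, ContDiff ℝ 1 (fun θ => b θ i))
    (hc : ∀ j, ContDiff ℝ 1 (fun θ => c θ j))
    (θbar : Fin k → ℝ)
    -- the optimal value `ϑ(θ̄)` is finite:
    (hne : ∃ x : Fin n → ℝ, (A θbar).mulVec x = b θbar ∧ 0 ≤ x)
    (hbdd : BddBelow {v : ℝ | ∃ x : Fin n → ℝ,
      (A θbar).mulVec x = b θbar ∧ 0 ≤ x ∧ v = c θbar ⬝ᵥ x})
    -- the primal and dual optimal solution sets at `θ̄`: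
    (S D : Set _)
    (hS : S = {x : Fin n → ℝ | (A θbar).mulVec x = b θbar ∧ 0 ≤ x ∧
      c θbar ⬝ᵥ x = parLPValue A b c θbar})
    (hD : D = {π : Fin m → ℝ | (A θbar)ᵀ.mulVec π ≤ c θbar ∧
      b θbar ⬝ᵥ π = parLPValue A b c θbar})
    (hSne : S.Nonempty) (hSbdd : Bornology.IsBounded S)
    (hDne : D.Nonempty) (hDbdd : Bornology.IsBounded D) :
    ∀ h : Fin k → ℝ, ∃ d : ℝ,
      IsGreatest {d' : ℝ | ∃ π ∈ D,
        IsLeast {e : ℝ | ∃ x ∈ S,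
          e = fderiv ℝ (parLPLagrangian A b c x π) θbar h} d'} d ∧
      Tendsto (fun t : ℝ =>
          (parLPValue A b c (θbar + t • h) - parLPValue A b c θbar) / t)
        (𝓝[>] 0) (𝓝 d) := by
  intro h
  have hcd : ∀ j, DifferentiableAt ℝ (fun θ => c θ j) θbar := fun j =>
    (hc j).differentiable one_ne_zero _
  have hbd : ∀ j, DifferentiableAt ℝ (fun θ => b θ j) θbar := fun j =>
    (hb j).differentiable one_ne_zero _
  have hAd : ∀ i j, DifferentiableAt ℝ (fun θ => A θ i j) θbar := fun i j =>
    (hA i j).differentiable one_ne_zero _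
  set c' : Fin n → ℝ := fun j => fderiv ℝ (fun θ => c θ j) θbar h with hc'
  set b' : Fin m → ℝ := fun j => fderiv ℝ (fun θ => b θ j) θbar h with hb'
  set A' : Matrix (Fin m) (Fin n) ℝ := fun i j => fderiv ℝ (fun θ => A θ i j) θbar h with hA'
  have tc : Tendsto (fun t : ℝ => t⁻¹ • (c (θbar + t • h) - c θbar)) (𝓝[>] 0) (𝓝 c') :=
    tendsto_pi_nhds.2 fun j => quot_tendsto (hcd j) h
  have tb : Tendsto (fun t : ℝ => t⁻¹ • (b (θbar + t • h) - b θbar)) (𝓝[>] 0) (𝓝 b') :=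
    tendsto_pi_nhds.2 fun j => quot_tendsto (hbd j) h
  have tA : Tendsto (fun t : ℝ => t⁻¹ • (A (θbar + t • h) - A θbar)) (𝓝[>] 0) (𝓝 A') :=
    tendsto_pi_nhds.2 fun i => tendsto_pi_nhds.2 fun j => quot_tendsto (hAd i j) h
  have tθ : Tendsto (fun t : ℝ => θbar + t • h) (𝓝[>] 0) (𝓝 θbar) := by
    have : Continuous (fun t : ℝ => θbar + t • h) := by fun_prop
    have := this.tendsto 0
    simp only [zero_smul, add_zero] at this
    exact this.mono_left nhdsWithin_le_nhds
  have tc0 : Tendsto (fun t : ℝ => c (θbar + t • h)) (𝓝[>] 0) (𝓝 (c θbar)) :=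
    tendsto_pi_nhds.2 fun j => (hcd j).continuousAt.tendsto.comp tθ
  have tb0 : Tendsto (fun t : ℝ => b (θbar + t • h)) (𝓝[>] 0) (𝓝 (b θbar)) :=
    tendsto_pi_nhds.2 fun j => (hbd j).continuousAt.tendsto.comp tθ
  have tA0 : Tendsto (fun t : ℝ => A (θbar + t • h)) (𝓝[>] 0) (𝓝 (A θbar)) :=
    tendsto_pi_nhds.2 fun i => tendsto_pi_nhds.2 fun j => (hAd i j).continuousAt.tendsto.comp tθ
  -- the derivative of the Lagrangian
  have hL : ∀ x π, fderiv ℝ (parLPLagrangian A b c x π) θbar h = lpF c' b' A' x π := by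
    intro x π
    have hd : DifferentiableAt ℝ (parLPLagrangian A b c x π) θbar := by
      unfold parLPLagrangian
      simp only [dotProduct, mulVec, Pi.sub_apply]
      fun_prop
    refine tendsto_nhds_unique (quot_tendsto hd h) ?_
    refine (lpF_tendsto tc tb tA (tendsto_const_nhds (x := x))
      (tendsto_const_nhds (x := π))).congr fun t => ?_
    exact lpF_quot _ _ _ _ _ _ _ _ _
  set v := parLPValue A b c θbar with hv
  have memS : ∀ x, x ∈ S ↔ (A θbar).mulVec x = b θbar ∧ 0 ≤ x ∧ c θbar ⬝ᵥ x = v := by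
    intro x; rw [hS]; rfl
  have memD : ∀ π, π ∈ D ↔ (A θbar)ᵀ.mulVec π ≤ c θbar ∧ b θbar ⬝ᵥ π = v := by
    intro x; rw [hD]; rfl
  have cS : Convex ℝ S := by
    intro x hx z hz s t hs ht hst
    rw [memS] at *
    refine ⟨?_, add_nonneg (smul_nonneg hs hx.2.1) (smul_nonneg ht hz.2.1), ?_⟩
    · rw [mulVec_add, mulVec_smul, mulVec_smul, hx.1, hz.1, ← add_smul, hst, one_smul]
    · rw [dotProduct_add, dotProduct_smul, dotProduct_smul, hx.2.2, hz.2.2, ← add_smul, hst,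
        one_smul]
  have cD : Convex ℝ D := by
    intro x hx z hz s t hs ht hst
    rw [memD] at *
    refine ⟨?_, ?_⟩
    · rw [mulVec_add, mulVec_smul, mulVec_smul]
      calc _ ≤ s • c θbar + t • c θbar :=
            add_le_add (smul_le_smul_of_nonneg_left hx.1 hs) (smul_le_smul_of_nonneg_left hz.1 ht)
        _ = _ := by rw [← add_smul, hst, one_smul]
    · rw [dotProduct_add, dotProduct_smul, dotProduct_smul, hx.2, hz.2, ← add_smul, hst,
        one_smul]
  have kS : IsCompact S := by
    refine Metric.isCompact_of_isClosed_isBounded ?_ hSbdd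
    rw [hS]
    simp only [Set.setOf_and]
    refine IsClosed.inter ?_ (IsClosed.inter ?_ ?_)
    · exact isClosed_eq (by fun_prop) (by fun_prop)
    · exact isClosed_le (by fun_prop) (by fun_prop)
    · exact isClosed_eq (by fun_prop) (by fun_prop)
  have kD : IsCompact D := by
    refine Metric.isCompact_of_isClosed_isBounded ?_ hDbdd
    rw [hD]
    simp only [Set.setOf_and]
    refine IsClosed.inter ?_ ?_
    · exact isClosed_le (by fun_prop) (by fun_prop)
    · exact isClosed_eq (by fun_prop) (by fun_prop)
  obtain ⟨xh, hxh, πh, hπh, hsad⟩ := lpF_saddle c' b' A' hSne cS kS hDne cD kD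
  refine ⟨lpF c' b' A' xh πh, ⟨⟨πh, hπh, ⟨xh, hxh, (hL _ _).symm⟩, ?_⟩, ?_⟩, ?_⟩
  · rintro e ⟨x, hx, rfl⟩
    rw [hL]
    exact hsad x hx πh hπh
  · rintro d' ⟨π, hπ, hleast⟩
    refine (hleast.2 ⟨xh, hxh, rfl⟩).trans ?_
    rw [hL]
    exact hsad xh hxh π hπ
  -- the limit
  obtain ⟨R1, hR1⟩ := hSbdd.exists_norm_le
  obtain ⟨R2, hR2⟩ := hDbdd.exists_norm_le
  set R := max R1 R2 + 1 with hR
  have hSR : ∀ x ∈ S, ‖x‖ < R := fun x hx => by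
    have := hR1 x hx
    have := le_max_left R1 R2
    linarith
  have hDR : ∀ x ∈ D, ‖x‖ < R := fun x hx => by
    have := hR2 x hx
    have := le_max_right R1 R2
    linarith
  have hRpos : 0 ≤ R := (norm_nonneg _).trans (hSR xh hxh).le
  set X : Set (Fin n → ℝ) := {x | 0 ≤ x} ∩ Metric.closedBall 0 R with hX
  set Y : Set (Fin m → ℝ) := Metric.closedBall 0 R with hY
  have memX : ∀ x, x ∈ X ↔ 0 ≤ x ∧ ‖x‖ ≤ R := by intro x; simp [hX]
  have memY : ∀ x, x ∈ Y ↔ ‖x‖ ≤ R := by intro x; simp [hY]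
  have kX : IsCompact X :=
    (isCompact_closedBall 0 R).inter_left (isClosed_le (by fun_prop) (by fun_prop))
  have kY : IsCompact Y := isCompact_closedBall 0 R
  have cX : Convex ℝ X := (convex_Ici 0).inter (convex_closedBall 0 R)
  have cY : Convex ℝ Y := convex_closedBall 0 R
  have nX : X.Nonempty := ⟨0, by rw [memX]; simpa using hRpos⟩
  have nY : Y.Nonempty := ⟨0, by rw [memY]; simpa using hRpos⟩
  have hex : ∀ t : ℝ, ∃ a ∈ X, ∃ β ∈ Y, ∀ x ∈ X, ∀ y ∈ Y,
      lpF (c (θbar + t • h)) (b (θbar + t • h)) (A (θbar + t • h)) a y ≤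
      lpF (c (θbar + t • h)) (b (θbar + t • h)) (A (θbar + t • h)) x β := fun t =>
    lpF_saddle _ _ _ nX cX kX nY cY kY
  choose xt hxt πt hπt hst using hex
  have hxhS := (memS _).1 hxh
  have hπhD := (memD _).1 hπh
  have hxX : xh ∈ X := (memX _).2 ⟨hxhS.2.1, (hSR _ hxh).le⟩
  have hπY : πh ∈ Y := (memY _).2 (hDR _ hπh).le
  rw [tendsto_iff_ultrafilter]
  intro U hU
  have hU' : (U : Filter ℝ) ≤ 𝓝[>] 0 := hU
  obtain ⟨xs, hxs, hxl⟩ := kX.ultrafilter_le_nhds (U.map xt) (by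
    rw [le_principal_iff]; exact Filter.mem_map.2 (Filter.univ_mem' hxt))
  obtain ⟨πs, hπs, hπl⟩ := kY.ultrafilter_le_nhds (U.map πt) (by
    rw [le_principal_iff]; exact Filter.mem_map.2 (Filter.univ_mem' hπt))
  have hxl : Tendsto xt U (𝓝 xs) := hxl
  have hπl : Tendsto πt U (𝓝 πs) := hπl
  have hsl : ∀ x ∈ X, ∀ y ∈ Y, lpF (c θbar) (b θbar) (A θbar) xs y ≤
      lpF (c θbar) (b θbar) (A θbar) x πs := by
    intro x hx y hy
    exact le_of_tendsto_of_tendsto'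
      (lpF_tendsto (tc0.mono_left hU') (tb0.mono_left hU') (tA0.mono_left hU') hxl
        (tendsto_const_nhds (x := y)))
      (lpF_tendsto (tc0.mono_left hU') (tb0.mono_left hU') (tA0.mono_left hU')
        (tendsto_const_nhds (x := x)) hπl) fun t => hst t x hx y hy
  have hfx : ∀ y, lpF (c θbar) (b θbar) (A θbar) xh y = v := fun y => by
    rw [lpF_feas y hxhS.1, hxhS.2.2]
  have hfπ : ∀ x, 0 ≤ x → v ≤ lpF (c θbar) (b θbar) (A θbar) x πh := fun x hx => by
    rw [← hπhD.2]; exact lpF_dual hx hπhD.1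
  have hxsS : xs ∈ S := by
    have h0 := ((memX _).1 hxs).1
    have h1 : (A θbar).mulVec xs = b θbar := lpF_K1 (p := c θbar) (hDR _ hπh) fun y hy => by
      have := hsl xh hxX y ((memY _).2 hy)
      rw [hfx] at this
      exact this.trans (hfπ _ h0)
    have h2 := hsl xh hxX πh hπY
    have h3 := hfπ _ h0
    rw [hfx, lpF_feas _ h1] at h2
    rw [lpF_feas _ h1] at h3
    exact (memS _).2 ⟨h1, h0, le_antisymm h2 h3⟩
  have hπsD : πs ∈ D := by
    have h0 := ((memX _).1 hxs).1
    have h1 := lpF_K2 (p := c θbar) (q := b θbar) (M := A θbar) (y := πs) hxhS.2.1 (hSR _ hxh)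
      fun x hx hx' => by
        rw [hfx]
        exact (hfπ _ h0).trans (hsl x ((memX _).2 ⟨hx, hx'⟩) πh hπY)
    rw [hfx] at h1
    exact (memD _).2 h1
  -- eventually strong duality
  have ev : ∀ᶠ t in (U : Filter ℝ), parLPValue A b c (θbar + t • h) =
      lpF (c (θbar + t • h)) (b (θbar + t • h)) (A (θbar + t • h)) (xt t) (πt t) := by
    filter_upwards [hxl.norm.eventually_lt_const (hSR _ hxsS),
      hπl.norm.eventually_lt_const (hDR _ hπsD)] with t h1 h2
    have h0 := ((memX _).1 (hxt t)).1
    have h3 : (A (θbar + t • h)).mulVec (xt t) = b (θbar + t • h) :=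
      lpF_K1 (p := c (θbar + t • h)) h2 fun y hy => hst t _ (hxt t) y ((memY _).2 hy)
    obtain ⟨h4, h5⟩ := lpF_K2 (p := c (θbar + t • h)) (q := b (θbar + t • h))
      (M := A (θbar + t • h)) (y := πt t) h0 h1 fun x hx hx' =>
        hst t x ((memX _).2 ⟨hx, hx'⟩) _ (hπt t)
    rw [lpF_feas _ h3] at h5 ⊢
    exact lp_value h0 h3 h4 h5
  have epos : ∀ᶠ t in (U : Filter ℝ), 0 < t := hU' self_mem_nhdsWithin
  have lo := lpF_tendsto (tc.mono_left hU') (tb.mono_left hU') (tA.mono_left hU') hxl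
    (tendsto_const_nhds (x := πh))
  have up := lpF_tendsto (tc.mono_left hU') (tb.mono_left hU') (tA.mono_left hU')
    (tendsto_const_nhds (x := xh)) hπl
  have hlo : ∀ᶠ t in (U : Filter ℝ), lpF (t⁻¹ • (c (θbar + t • h) - c θbar))
      (t⁻¹ • (b (θbar + t • h) - b θbar)) (t⁻¹ • (A (θbar + t • h) - A θbar)) (xt t) πh ≤
      (parLPValue A b c (θbar + t • h) - v) / t := by
    filter_upwards [ev, epos] with t h1 h2
    rw [lpF_quot, h1, div_eq_inv_mul]
    refine mul_le_mul_of_nonneg_left ?_ (inv_pos.2 h2).le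
    exact sub_le_sub (hst t _ (hxt t) _ hπY) (hfπ _ ((memX _).1 (hxt t)).1)
  have hup : ∀ᶠ t in (U : Filter ℝ), (parLPValue A b c (θbar + t • h) - v) / t ≤
      lpF (t⁻¹ • (c (θbar + t • h) - c θbar))
      (t⁻¹ • (b (θbar + t • h) - b θbar)) (t⁻¹ • (A (θbar + t • h) - A θbar)) xh (πt t) := by
    filter_upwards [ev, epos] with t h1 h2
    rw [lpF_quot, h1, div_eq_inv_mul]
    refine mul_le_mul_of_nonneg_left ?_ (inv_pos.2 h2).le
    exact sub_le_sub (hst t _ hxX _ (hπt t)) (hfx _).le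
  have e1 : lpF c' b' A' xs πh ≤ lpF c' b' A' xh πs :=
    le_of_tendsto_of_tendsto lo up (by filter_upwards [hlo, hup] with t h1 h2 using h1.trans h2)
  have e2 := hsad xs hxsS πh hπh
  have e3 := hsad xh hxh πs hπsD
  rw [show lpF c' b' A' xs πh = lpF c' b' A' xh πh by linarith] at lo
  rw [show lpF c' b' A' xh πs = lpF c' b' A' xh πh by linarith] at up
  exact tendsto_of_tendsto_of_tendsto_of_le_of_le' lo up hlo hup
end

section
/- Suppose the entries of c(θ), b(θ) and A(θ) are continuously differentiable functions of θ, that at θ = θ̄ the optimal value ϑ(θ̄) is finite, and that the optimal solution sets are singletons: 𝔖(θ̄) = {x̄} and 𝔇(θ̄) = {π̄}. Then ϑ is differentiable at θ̄ and ∇ϑ(θ̄) = ∇_θ L(x̄, π̄, θ̄). -/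
open Matrix

lemma cone_top {E : Type*} [NormedAddCommGroup E] [NormedSpace ℝ E] [FiniteDimensional ℝ E]
    (C : Set E) (h0 : (0:E) ∈ C) (hadd : ∀ x ∈ C, ∀ y ∈ C, x + y ∈ C)
    (hsm : ∀ t : ℝ, 0 ≤ t → ∀ x ∈ C, t • x ∈ C)
    (h : ∀ f : E →ₗ[ℝ] ℝ, (∀ a ∈ C, f a ≤ 0) → f = 0) (y : E) : y ∈ C := by
  by_contra hy
  have hconv : Convex ℝ C := by
    intro a ha b hb s t hs ht _
    exact hadd _ (hsm s hs a ha) _ (hsm t ht b hb)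
  have hspan : Submodule.span ℝ C = ⊤ := by
    by_contra hne
    obtain ⟨f, hf0, hf⟩ := Submodule.exists_le_ker_of_lt_top _ (lt_top_iff_ne_top.2 hne)
    exact hf0 (h f fun a ha => le_of_eq (hf (Submodule.subset_span ha)))
  have hint : (interior C).Nonempty := by
    rw [hconv.interior_nonempty_iff_affineSpan_eq_top]
    rw [AffineSubspace.affineSpan_eq_top_iff_vectorSpan_eq_top_of_nonempty ℝ E E ⟨0, h0⟩]
    rw [vectorSpan_eq_span_vsub_set_right ℝ h0]
    simpa using hspan
  obtain ⟨f, hf0, hf⟩ := geometric_hahn_banach_of_nonempty_interior_point hconv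
    (fun hh => hy (interior_subset hh)) hint
  apply hf0
  have := h f.toLinearMap (by
    intro a ha
    by_contra hpos
    push Not at hpos
    simp only [ContinuousLinearMap.coe_coe] at hpos
    have h1 : 0 ≤ f y := by simpa using hf 0 h0
    have h2 := hf _ (hsm ((f y + 1) / f a) (by positivity) a ha)
    rw [map_smul, smul_eq_mul, div_mul_cancel₀ _ hpos.ne'] at h2
    linarith)
  ext z
  exact LinearMap.congr_fun this z

lemma eps_exists {n : ℕ} (u v : Fin n → ℝ) (hu : 0 ≤ u) (h : ∀ j, u j = 0 → 0 ≤ v j) :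
    ∃ ε : ℝ, 0 < ε ∧ 0 ≤ u + ε • v := by
  have : ∀ᶠ ε : ℝ in nhdsWithin 0 (Set.Ioi 0), ∀ j, 0 ≤ u j + ε * v j := by
    rw [Filter.eventually_all]
    intro j
    rcases (hu j).eq_or_lt with hj | hj
    · filter_upwards [self_mem_nhdsWithin] with ε hε
      have := h j hj.symm
      have hε : 0 < ε := hε
      rw [← hj]
      simp only [Pi.zero_apply]
      positivity
    · apply Filter.Eventually.filter_mono nhdsWithin_le_nhds
      have hc : ContinuousAt (fun ε : ℝ => u j + ε * v j) 0 := by fun_prop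
      exact (hc.eventually (lt_mem_nhds (a := 0) (by simpa using hj))).mono fun _ => le_of_lt
  obtain ⟨ε, h1, h2⟩ := (this.and self_mem_nhdsWithin).exists
  exact ⟨ε, h2, fun j => by simpa using h1 j⟩

/-- Extend a vector by zero. -/
def extv {m n : ℕ} (e : Fin m → Fin n) (y : Fin m → ℝ) : Fin n → ℝ :=
  fun j => ∑ i, if e i = j then y i else 0

lemma dot_extv {m n : ℕ} (e : Fin m → Fin n) (y : Fin m → ℝ) (w : Fin n → ℝ) :
    w ⬝ᵥ extv e y = (fun i => w (e i)) ⬝ᵥ y := by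
  simp only [dotProduct, extv, Finset.mul_sum]
  rw [Finset.sum_comm]
  simp

lemma mulVec_extv {m n : ℕ} (e : Fin m → Fin n) (y : Fin m → ℝ)
    (A : Matrix (Fin m) (Fin n) ℝ) :
    A *ᵥ extv e y = (A.submatrix id e) *ᵥ y := by
  ext i
  exact dot_extv e y (A i)

lemma lp_basis {m n : ℕ} (A : Matrix (Fin m) (Fin n) ℝ) (b : Fin m → ℝ) (c : Fin n → ℝ)
    (x : Fin n → ℝ) (p : Fin m → ℝ) (hx : A *ᵥ x = b) (hx0 : 0 ≤ x) (hp : Aᵀ *ᵥ p ≤ c)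
    (hv : b ⬝ᵥ p = c ⬝ᵥ x)
    (huP : ∀ x', A *ᵥ x' = b → 0 ≤ x' → c ⬝ᵥ x' = c ⬝ᵥ x → x' = x)
    (huD : ∀ p', Aᵀ *ᵥ p' ≤ c → b ⬝ᵥ p' = c ⬝ᵥ x → p' = p) :
    ∃ e : Fin m → Fin n, Function.Injective e ∧ (∀ i, 0 < x (e i)) ∧
      (∀ j, j ∉ Set.range e → x j = 0 ∧ (Aᵀ *ᵥ p) j < c j) ∧
      (∀ i, (Aᵀ *ᵥ p) (e i) = c (e i)) ∧ IsUnit (A.submatrix id e).det := by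
  classical
  have htr : ∀ (q : Fin m → ℝ) (z : Fin n → ℝ), (Aᵀ *ᵥ q) ⬝ᵥ z = q ⬝ᵥ (A *ᵥ z) := by
    intro q z
    rw [Matrix.mulVec_transpose, Matrix.dotProduct_mulVec]
  set r : Fin n → ℝ := c - Aᵀ *ᵥ p with hr
  have hr0 : 0 ≤ r := sub_nonneg.2 hp
  have hrx : r ⬝ᵥ x = 0 := by
    rw [hr, sub_dotProduct, htr, hx, ← hv, dotProduct_comm b p, sub_self]
  have hcomp : ∀ j, r j * x j = 0 := by
    have := (Finset.sum_eq_zero_iff_of_nonneg (s := Finset.univ) (f := fun j => r j * x j)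
      (fun j _ => mul_nonneg (hr0 j) (hx0 j))).1 hrx
    exact fun j => this j (Finset.mem_univ _)
  -- primal directions
  have hP : ∀ d : Fin n → ℝ, A *ᵥ d = 0 → (∀ j, r j ≠ 0 → d j = 0) →
      (∀ j, x j = 0 → 0 ≤ d j) → d = 0 := by
    intro d hd hdr hdx
    obtain ⟨ε, hε, hpos⟩ := eps_exists x d hx0 hdx
    have hrd : r ⬝ᵥ d = 0 := Finset.sum_eq_zero fun j _ => by
      by_cases h : r j = 0
      · simp [h]
      · simp [hdr j h]
    have hcd : c ⬝ᵥ d = 0 := by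
      have : c = r + Aᵀ *ᵥ p := by simp [hr]
      rw [this, add_dotProduct, hrd, htr, hd]; simp
    have := huP (x + ε • d) (by rw [Matrix.mulVec_add, Matrix.mulVec_smul, hd, hx]; simp) hpos
      (by rw [dotProduct_add, dotProduct_smul, hcd]; simp)
    have : ε • d = 0 := by simpa using this
    exact (smul_eq_zero.1 this).resolve_left hε.ne'
  have hDd : ∀ q : Fin m → ℝ, (∀ j, r j = 0 → (Aᵀ *ᵥ q) j ≤ 0) →
      (∀ j, 0 < x j → (Aᵀ *ᵥ q) j = 0) → q = 0 := by
    intro q hq1 hq2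
    obtain ⟨ε, hε, hpos⟩ := eps_exists r (-(Aᵀ *ᵥ q)) hr0 (fun j hj => by
      simpa using hq1 j hj)
    have hbq : b ⬝ᵥ q = 0 := by
      rw [← hx, dotProduct_comm, ← htr]
      refine Finset.sum_eq_zero fun j _ => ?_
      rcases (hx0 j).eq_or_lt with h | h
      · rw [← h]; simp
      · rw [hq2 j h]; simp
    have := huD (p + ε • q) (by
        intro j
        have := hpos j
        rw [Matrix.mulVec_add, Matrix.mulVec_smul]
        simp [hr] at this ⊢
        linarith) (by rw [dotProduct_add, dotProduct_smul, hbq, hv]; simp)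
    have : ε • q = 0 := by simpa using this
    exact (smul_eq_zero.1 this).resolve_left hε.ne'
  -- the cone
  have hcone : ∀ y : Fin m → ℝ, ∃ d : Fin n → ℝ, (∀ j, r j ≠ 0 → d j = 0) ∧
      (∀ j, x j = 0 → 0 ≤ d j) ∧ A *ᵥ d = y := by
    intro y
    refine cone_top {y | ∃ d : Fin n → ℝ, (∀ j, r j ≠ 0 → d j = 0) ∧
      (∀ j, x j = 0 → 0 ≤ d j) ∧ A *ᵥ d = y} ⟨0, by simp, by simp, by simp⟩ ?_ ?_ ?_ y
    · rintro _ ⟨d, h1, h2, rfl⟩ _ ⟨d', h1', h2', rfl⟩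
      refine ⟨d + d', fun j hj => by simp [h1 j hj, h1' j hj],
        fun j hj => add_nonneg (h2 j hj) (h2' j hj), Matrix.mulVec_add _ _ _⟩
    · rintro t ht _ ⟨d, h1, h2, rfl⟩
      exact ⟨t • d, fun j hj => by simp [h1 j hj],
        fun j hj => mul_nonneg ht (h2 j hj), Matrix.mulVec_smul _ _ _⟩
    · intro f hf
      let q : Fin m → ℝ := fun i => f (Pi.single i 1)
      have hfq : ∀ z, f z = q ⬝ᵥ z := by
        intro z
        conv_lhs => rw [← Finset.univ_sum_single z]
        rw [map_sum]
        refine Finset.sum_congr rfl fun i _ => ?_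
        have : (Pi.single i (z i) : Fin m → ℝ) = z i • Pi.single i 1 := by
          rw [← Pi.single_smul]; simp
        rw [this, map_smul, smul_eq_mul, mul_comm]
      have hq : ∀ j (t : ℝ), r j = 0 → (x j = 0 → 0 ≤ t) → (Aᵀ *ᵥ q) j * t ≤ 0 := by
        intro j t hj ht
        have := hf (A *ᵥ Pi.single j t) ⟨Pi.single j t, fun j' hj' => by
          have : j' ≠ j := fun h => hj' (h ▸ hj)
          simp [this], fun j' hj' => by
          by_cases h : j' = j
          · subst h; simpa using ht hj'
          · simp [h], rfl⟩
        rw [hfq, ← htr, dotProduct_single] at this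
        exact this
      have hq0 : q = 0 := hDd q (fun j hj => by simpa using hq j 1 hj (by simp))
        (fun j hj => by
          have hj0 : r j = 0 := by
            have := hcomp j
            rcases mul_eq_zero.1 this with h | h
            · exact h
            · exact absurd h hj.ne'
          have h1 := hq j 1 hj0 (by simp)
          have h2 := hq j (-1) hj0 (fun h => absurd h hj.ne')
          linarith)
      ext z
      simp [hfq, hq0]
  have hstrict : ∀ j, r j = 0 → 0 < x j := by
    intro j hj
    by_contra hxj
    have hxj : x j = 0 := le_antisymm (not_lt.1 hxj) (hx0 j)
    obtain ⟨d, h1, h2, h3⟩ := hcone (-(A *ᵥ Pi.single j 1))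
    have := hP (d + Pi.single j 1) (by rw [Matrix.mulVec_add, h3]; simp) (fun j' hj' => by
          have : j' ≠ j := fun h => hj' (h ▸ hj)
          simp [this, h1 j' hj']) (fun j' hj' => by
          have := h2 j' hj'
          have h4 : 0 ≤ (Pi.single j 1 : Fin n → ℝ) j' := by
            by_cases h : j' = j
            · subst h; simp
            · simp [h]
          exact add_nonneg this h4)
    have h5 := congrFun this j
    have := h2 j hxj
    simp at h5
    linarith
  have hB : ∀ j, r j = 0 ↔ 0 < x j := fun j => ⟨hstrict j, fun h => by
    rcases mul_eq_zero.1 (hcomp j) with h' | h'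
    · exact h'
    · exact absurd h' h.ne'⟩
  -- the basis
  let B := {j // 0 < x j}
  let ι : (B → ℝ) → Fin n → ℝ := fun y j => if h : 0 < x j then y ⟨j, h⟩ else 0
  have hι : ∀ y : B → ℝ, A *ᵥ ι y = (A.submatrix id (Subtype.val : B → Fin n)) *ᵥ y := by
    intro y
    ext i
    simp only [Matrix.mulVec, dotProduct, Matrix.submatrix_apply, id]
    have h1 : ∀ j ∈ Finset.univ, j ∉ Finset.univ.filter (fun j => 0 < x j) →
        A i j * ι y j = 0 := by
      intro j _ hj
      have : ¬ 0 < x j := by simpa using hj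
      simp [ι, this]
    rw [← Finset.sum_subset (Finset.filter_subset _ _) h1]
    rw [Finset.sum_subtype (p := fun j => 0 < x j) _ (by simp)]
    refine Finset.sum_congr rfl fun j _ => ?_
    simp [ι, j.2]
  have hbij : Function.Bijective
      (Matrix.mulVecLin (A.submatrix id (Subtype.val : B → Fin n))) := by
    constructor
    · rw [← LinearMap.ker_eq_bot, LinearMap.ker_eq_bot']
      intro y hy
      rw [Matrix.mulVecLin_apply, ← hι] at hy
      have := hP (ι y) hy (fun j hj => by
        have : ¬ 0 < x j := fun h => hj ((hB j).2 h)
        simp [ι, this]) (fun j hj => by simp [ι, hj])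
      ext j
      have := congrFun this j.1
      simpa [ι, j.2] using this
    · intro y
      obtain ⟨d, h1, h2, h3⟩ := hcone y
      refine ⟨fun j => d j.1, ?_⟩
      rw [Matrix.mulVecLin_apply, ← hι, ← h3]
      congr 1
      ext j
      by_cases h : 0 < x j
      · simp [ι, h]
      · simp only [ι, h, dif_neg, not_false_eq_true]
        exact (h1 j fun h' => h ((hB j).1 h')).symm
  have hcard : Fintype.card (Fin m) = Fintype.card B := by
    have := (LinearEquiv.ofBijective _ hbij).finrank_eq
    simpa using this.symm
  let e := Fintype.equivOfCardEq hcard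
  refine ⟨fun i => (e i).1, Subtype.val_injective.comp e.injective, fun i => (e i).2, ?_, ?_, ?_⟩
  · intro j hj
    have hxj : ¬ 0 < x j := fun h => hj ⟨e.symm ⟨j, h⟩, by simp⟩
    refine ⟨le_antisymm (not_lt.1 hxj) (hx0 j), ?_⟩
    have h1 : r j ≠ 0 := fun h => hxj ((hB j).1 h)
    have := lt_of_le_of_ne (hr0 j) h1.symm
    simpa [hr] using this
  · intro i
    have := (hB (e i).1).2 (e i).2
    simp only [hr, Pi.sub_apply] at this
    linarith
  · rw [← Matrix.isUnit_iff_isUnit_det, ← Matrix.mulVec_injective_iff_isUnit]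
    intro y y' hyy
    have key : ∀ y : Fin m → ℝ, (A.submatrix id (fun i => (e i).1)) *ᵥ y =
        (A.submatrix id (Subtype.val : B → Fin n)) *ᵥ (y ∘ e.symm) := by
      intro y
      ext i
      simp only [Matrix.mulVec, dotProduct, Matrix.submatrix_apply, id]
      exact Fintype.sum_equiv e _ _ (fun k => by simp)
    have h1 : (A.submatrix id (fun i => (e i).1)) *ᵥ y =
      (A.submatrix id (fun i => (e i).1)) *ᵥ y' := hyy
    rw [key, key] at h1
    have := hbij.1 h1
    ext i
    simpa using congrFun this (e i)

lemma lp_value_s2 {m n : ℕ} (A : Matrix (Fin m) (Fin n) ℝ) (b : Fin m → ℝ) (c : Fin n → ℝ)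
    (x : Fin n → ℝ) (p : Fin m → ℝ) (hx : A *ᵥ x = b) (hx0 : 0 ≤ x) (hp : Aᵀ *ᵥ p ≤ c)
    (hv : b ⬝ᵥ p = c ⬝ᵥ x) :
    sInf {v : ℝ | ∃ x : Fin n → ℝ, A.mulVec x = b ∧ 0 ≤ x ∧ v = c ⬝ᵥ x} = c ⬝ᵥ x := by
  apply IsLeast.csInf_eq
  refine ⟨⟨x, hx, hx0, rfl⟩, ?_⟩
  rintro _ ⟨x', h1, h2, rfl⟩
  rw [← hv, ← h1, dotProduct_comm, Matrix.dotProduct_mulVec, ← Matrix.mulVec_transpose]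
  exact dotProduct_le_dotProduct_of_nonneg_right hp h2

lemma diff_det {k m : ℕ} (M : (Fin k → ℝ) → Matrix (Fin m) (Fin m) ℝ)
    (hM : ∀ i j, Differentiable ℝ (fun θ => M θ i j)) :
    Differentiable ℝ (fun θ => (M θ).det) := by
  simp only [Matrix.det_apply]
  have : ∀ σ : Equiv.Perm (Fin m), Differentiable ℝ (fun θ => ∏ i, M θ (σ i) i) := by
    intro σ θ
    exact (HasFDerivAt.finsetProd (u := Finset.univ) (g := fun i θ => M θ (σ i) i)
      (fun i _ => (hM (σ i) i θ).hasFDerivAt)).differentiableAt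
  refine Differentiable.fun_sum fun σ _ => ?_
  exact (this σ).const_smul _

lemma diff_inv {k m : ℕ} (M : (Fin k → ℝ) → Matrix (Fin m) (Fin m) ℝ)
    (hM : ∀ i j, Differentiable ℝ (fun θ => M θ i j)) (θ₀ : Fin k → ℝ)
    (h : (M θ₀).det ≠ 0) (i j : Fin m) :
    DifferentiableAt ℝ (fun θ => (M θ)⁻¹ i j) θ₀ := by
  simp only [Matrix.inv_def, Matrix.smul_apply, Ring.inverse_eq_inv', smul_eq_mul,
    Matrix.adjugate_apply]
  refine DifferentiableAt.mul (DifferentiableAt.inv (diff_det M hM θ₀) h) ?_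
  refine diff_det (fun θ => (M θ).updateRow j (Pi.single i 1)) ?_ θ₀
  intro a b
  simp only [Matrix.updateRow_apply]
  split_ifs
  · exact differentiable_const _
  · exact hM a b

/-- Differentiability of the optimal value of a parametric linear program:
if the data are continuously differentiable, the optimal value at `θ̄` is
finite, and the primal and dual optimal solution sets at `θ̄` are singletons
`{x̄}` and `{π̄}`, then `ϑ` is differentiable at `θ̄` with derivative
`∇_θ L(x̄,π̄,θ̄)`. -/
theorem parametric_lp_gradient {k m n : ℕ}
    (A : (Fin k → ℝ) → Matrix (Fin m) (Fin n) ℝ)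
    (b : (Fin k → ℝ) → Fin m → ℝ) (c : (Fin k → ℝ) → Fin n → ℝ)
    (hA : ∀ i j, ContDiff ℝ 1 (fun θ => A θ i j))
    (hb : ∀ i, ContDiff ℝ 1 (fun θ => b θ i))
    (hc : ∀ j, ContDiff ℝ 1 (fun θ => c θ j))
    (θbar : Fin k → ℝ)
    -- the optimal value `ϑ(θ̄)` is finite:
    (hne : ∃ x : Fin n → ℝ, (A θbar).mulVec x = b θbar ∧ 0 ≤ x)
    (hbdd : BddBelow {v : ℝ | ∃ x : Fin n → ℝ,
      (A θbar).mulVec x = b θbar ∧ 0 ≤ x ∧ v = c θbar ⬝ᵥ x})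
    (xbar : Fin n → ℝ) (pibar : Fin m → ℝ)
    -- the primal and dual optimal solution sets at `θ̄` are singletons:
    (hS : {x : Fin n → ℝ | (A θbar).mulVec x = b θbar ∧ 0 ≤ x ∧
      c θbar ⬝ᵥ x = parLPValue A b c θbar} = {xbar})
    (hD : {π : Fin m → ℝ | (A θbar)ᵀ.mulVec π ≤ c θbar ∧
      b θbar ⬝ᵥ π = parLPValue A b c θbar} = {pibar}) :
    HasFDerivAt (parLPValue A b c)
      (fderiv ℝ (parLPLagrangian A b c xbar pibar) θbar) θbar := by
  obtain ⟨hx, hx0, hxv⟩ : xbar ∈ {x : Fin n → ℝ | (A θbar).mulVec x = b θbar ∧ 0 ≤ x ∧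
      c θbar ⬝ᵥ x = parLPValue A b c θbar} := by rw [hS]; rfl
  obtain ⟨hp, hpv⟩ : pibar ∈ {π : Fin m → ℝ | (A θbar)ᵀ.mulVec π ≤ c θbar ∧
      b θbar ⬝ᵥ π = parLPValue A b c θbar} := by rw [hD]; rfl
  obtain ⟨e, he, hpos, hoff, hon, hdet⟩ := lp_basis (A θbar) (b θbar) (c θbar) xbar pibar
    hx hx0 hp (hpv.trans hxv.symm)
    (fun x' h1 h2 h3 => by
      have : x' ∈ {x : Fin n → ℝ | (A θbar).mulVec x = b θbar ∧ 0 ≤ x ∧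
        c θbar ⬝ᵥ x = parLPValue A b c θbar} := ⟨h1, h2, h3.trans hxv⟩
      rw [hS] at this; exact this)
    (fun p' h1 h3 => by
      have : p' ∈ {π : Fin m → ℝ | (A θbar)ᵀ.mulVec π ≤ c θbar ∧
        b θbar ⬝ᵥ π = parLPValue A b c θbar} := ⟨h1, h3.trans hxv⟩
      rw [hD] at this; exact this)
  have dA : ∀ i j, Differentiable ℝ (fun θ => A θ i j) :=
    fun i j => (hA i j).differentiable (by norm_num)
  have db : ∀ i, Differentiable ℝ (fun θ => b θ i) :=
    fun i => (hb i).differentiable (by norm_num)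
  have dc : ∀ i, Differentiable ℝ (fun θ => c θ i) :=
    fun i => (hc i).differentiable (by norm_num)
  let M : (Fin k → ℝ) → Matrix (Fin m) (Fin m) ℝ := fun θ => (A θ).submatrix id e
  let cB : (Fin k → ℝ) → Fin m → ℝ := fun θ i => c θ (e i)
  let y : (Fin k → ℝ) → Fin m → ℝ := fun θ => (M θ)⁻¹ *ᵥ b θ
  let p : (Fin k → ℝ) → Fin m → ℝ := fun θ => cB θ ᵥ* (M θ)⁻¹
  let ybar : Fin m → ℝ := fun i => xbar (e i)
  have dM : ∀ i j, Differentiable ℝ (fun θ => M θ i j) := fun i j => dA i (e j)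
  have hdet0 : (M θbar).det ≠ 0 := hdet.ne_zero
  have dinv := diff_inv M dM θbar hdet0
  have dy : ∀ i, DifferentiableAt ℝ (fun θ => y θ i) θbar := by
    intro i
    simp only [y, Matrix.mulVec, dotProduct]
    exact DifferentiableAt.fun_sum fun j _ => (dinv i j).mul (db j θbar)
  have dp : ∀ i, DifferentiableAt ℝ (fun θ => p θ i) θbar := by
    intro i
    simp only [p, Matrix.vecMul, dotProduct]
    exact DifferentiableAt.fun_sum fun j _ => (dc (e j) θbar).mul (dinv j i)
  have hMy : ∀ θ, (M θ).det ≠ 0 → M θ *ᵥ y θ = b θ := by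
    intro θ h
    simp only [y]
    rw [Matrix.mulVec_mulVec, Matrix.mul_nonsing_inv _ h.isUnit, Matrix.one_mulVec]
  have hMp : ∀ θ, (M θ).det ≠ 0 → p θ ᵥ* M θ = cB θ := by
    intro θ h
    simp only [p]
    rw [Matrix.vecMul_vecMul, Matrix.nonsing_inv_mul _ h.isUnit, Matrix.vecMul_one]
  have hext : extv e ybar = xbar := by
    ext j
    simp only [extv, ybar]
    by_cases hj : j ∈ Set.range e
    · obtain ⟨i, rfl⟩ := hj
      simp [he.eq_iff]
    · rw [(hoff j hj).1]
      refine Finset.sum_eq_zero fun i _ => ?_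
      rw [if_neg]
      exact fun h => hj ⟨i, h⟩
  have hy0 : y θbar = ybar := by
    have : M θbar *ᵥ ybar = b θbar := by
      rw [← mulVec_extv, hext, hx]
    simp only [y]
    rw [← this, Matrix.mulVec_mulVec, Matrix.nonsing_inv_mul _ hdet0.isUnit, Matrix.one_mulVec]
  have hp0 : p θbar = pibar := by
    have : pibar ᵥ* M θbar = cB θbar := by
      ext i
      have := hon i
      rw [Matrix.mulVec_transpose] at this
      exact this
    simp only [p]
    rw [← this, Matrix.vecMul_vecMul, Matrix.mul_nonsing_inv _ hdet0.isUnit, Matrix.vecMul_one]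
  -- eventually optimal
  have ev1 : ∀ᶠ θ in nhds θbar, (M θ).det ≠ 0 :=
    ((diff_det M dM).continuous.continuousAt).eventually_ne hdet0
  have ev2 : ∀ᶠ θ in nhds θbar, ∀ i, 0 < y θ i := by
    rw [Filter.eventually_all]
    intro i
    exact (dy i).continuousAt.eventually (lt_mem_nhds (by
      show 0 < y θbar i
      rw [hy0]; exact hpos i))
  have ev3 : ∀ᶠ θ in nhds θbar, ∀ j, j ∉ Set.range e → ((A θ)ᵀ *ᵥ p θ) j < c θ j := by
    rw [Filter.eventually_all]
    intro j
    by_cases hj : j ∈ Set.range e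
    · exact Filter.Eventually.of_forall fun θ h => absurd hj h
    have hcont : ContinuousAt (fun θ => ((A θ)ᵀ *ᵥ p θ) j) θbar := by
      simp only [Matrix.mulVec, dotProduct, Matrix.transpose_apply]
      have : DifferentiableAt ℝ (fun θ => ∑ i, A θ i j * p θ i) θbar :=
        DifferentiableAt.fun_sum fun i _ => (dA i j θbar).mul (dp i)
      exact this.continuousAt
    have := hcont.eventually_lt (dc j).continuous.continuousAt (by
      rw [hp0]; exact (hoff j hj).2)
    filter_upwards [this] with θ hθ _ using hθ
  let R : (Fin k → ℝ) → ℝ := fun θ =>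
    ∑ i, (p θ i - pibar i) * ∑ j, M θ i j * (y θ j - ybar j)
  have hR : HasFDerivAt R (0 : (Fin k → ℝ) →L[ℝ] ℝ) θbar := by
    have hterm : ∀ i ∈ Finset.univ, HasFDerivAt (fun θ =>
        (p θ i - pibar i) * ∑ j, M θ i j * (y θ j - ybar j)) (0 : (Fin k → ℝ) →L[ℝ] ℝ) θbar := by
      intro i _
      have d2 : DifferentiableAt ℝ (fun θ => ∑ j, M θ i j * (y θ j - ybar j)) θbar :=
        DifferentiableAt.fun_sum fun j _ => (dM i j θbar).mul ((dy j).sub_const _)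
      have := ((dp i).sub_const (pibar i)).hasFDerivAt.mul d2.hasFDerivAt
      refine this.congr_fderiv ?_
      simp [hp0, hy0]
    simpa using HasFDerivAt.fun_sum hterm
  have hL : DifferentiableAt ℝ (parLPLagrangian A b c xbar pibar) θbar := by
    unfold parLPLagrangian
    simp only [Matrix.mulVec, dotProduct, Pi.sub_apply]
    refine DifferentiableAt.add ?_ ?_
    · exact DifferentiableAt.fun_sum fun j _ => (dc j θbar).mul_const _
    · refine DifferentiableAt.fun_sum fun i _ => DifferentiableAt.const_mul ?_ _
      have : DifferentiableAt ℝ (fun θ => ∑ j, A θ i j * xbar j) θbar :=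
        DifferentiableAt.fun_sum fun j _ => (dA i j θbar).mul_const _
      exact (db i θbar).sub this
  have hsum := hL.hasFDerivAt.add hR
  rw [add_zero] at hsum
  refine hsum.congr_of_eventuallyEq ?_
  filter_upwards [ev1, ev2, ev3] with θ h1 h2 h3
  have hval : parLPValue A b c θ = c θ ⬝ᵥ extv e (y θ) := by
    apply lp_value_s2 (A θ) (b θ) (c θ) (extv e (y θ)) (p θ)
    · rw [mulVec_extv]; exact hMy θ h1
    · intro j
      refine Finset.sum_nonneg fun i _ => ?_
      split_ifs
      · exact (h2 i).le
      · exact le_rfl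
    · intro j
      by_cases hj : j ∈ Set.range e
      · obtain ⟨i, rfl⟩ := hj
        have := congrFun (hMp θ h1) i
        rw [Matrix.mulVec_transpose]
        exact this.le
      · exact (h3 j hj).le
    · rw [dot_extv, ← hMy θ h1, dotProduct_comm, Matrix.dotProduct_mulVec, hMp θ h1]
  have hRv : R θ = (p θ - pibar) ⬝ᵥ (M θ *ᵥ (y θ - ybar)) := rfl
  rw [hval, dot_extv]
  show cB θ ⬝ᵥ y θ = parLPLagrangian A b c xbar pibar θ + R θ
  rw [hRv, parLPLagrangian, ← hext, dot_extv, mulVec_extv]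
  show cB θ ⬝ᵥ y θ = cB θ ⬝ᵥ ybar + pibar ⬝ᵥ (b θ - M θ *ᵥ ybar) + _
  rw [← hMy θ h1, ← Matrix.mulVec_sub, sub_dotProduct, Matrix.dotProduct_mulVec (p θ), hMp θ h1,
    dotProduct_sub (cB θ)]
  ring
end

section
/- Suppose the linear program (P) has a finite optimal value and there exists a feasible point x̂ ∈ ℝⁿ (i.e., Ax̂ = b, x̂ ≥ 0) all of whose components are strictly positive. Then there exist vectors π̲, π̄ ∈ ℝᵐ such that adding the box constraints π̲ ≤ π ≤ π̄ to the dual problem does not change its optimal value: sup{b·π : Aᵀπ ≤ c} = sup{b·π : Aᵀπ ≤ c, π̲ ≤ π ≤ π̄}. -/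
open Matrix

/-- If the primal problem `min c·x s.t. Ax = b, x ≥ 0` has a finite optimal
value and possesses a strictly positive feasible point `x̂ > 0`, then there
exist bounds `π̲, π̄ ∈ ℝᵐ` such that adding the box constraints
`π̲ ≤ π ≤ π̄` to the dual problem `max b·π s.t. Aᵀπ ≤ c` does not change its
optimal value (optimal values taken in the extended reals). -/
theorem dual_lp_box_constraints {m n : ℕ}
    (A : Matrix (Fin m) (Fin n) ℝ) (b : Fin m → ℝ) (c : Fin n → ℝ)
    (hbdd : BddBelow {v : ℝ | ∃ x : Fin n → ℝ, A.mulVec x = b ∧ 0 ≤ x ∧ v = c ⬝ᵥ x})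
    (xhat : Fin n → ℝ) (hxhat_feas : A.mulVec xhat = b) (hxhat_pos : ∀ j, 0 < xhat j) :
    ∃ πlo πhi : Fin m → ℝ,
      sSup {w : EReal | ∃ π : Fin m → ℝ, Aᵀ.mulVec π ≤ c ∧ w = ((b ⬝ᵥ π : ℝ) : EReal)} =
      sSup {w : EReal | ∃ π : Fin m → ℝ, Aᵀ.mulVec π ≤ c ∧ πlo ≤ π ∧ π ≤ πhi ∧
        w = ((b ⬝ᵥ π : ℝ) : EReal)} := by
  by_cases hne : ∃ π : Fin m → ℝ, Aᵀ.mulVec π ≤ c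
  · obtain ⟨π, h1, h2⟩ : ∃ π : Fin m → ℝ, Aᵀ.mulVec π ≤ c ∧
        ∀ q : Fin m → ℝ, Aᵀ.mulVec q ≤ c → b ⬝ᵥ q ≤ b ⬝ᵥ π := by
      obtain ⟨p, hp⟩ := hne
      have key : ∀ q : Fin m → ℝ, b ⬝ᵥ q = xhat ⬝ᵥ (Aᵀ.mulVec q) := by
        intro q
        rw [← hxhat_feas, Matrix.mulVec_transpose, dotProduct_comm,
          Matrix.dotProduct_mulVec, dotProduct_comm]
      have hcl : IsClosed (LinearMap.range (Matrix.mulVecLin Aᵀ) : Set (Fin n → ℝ)) :=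
        Submodule.closed_of_finiteDimensional _
      have hcont : Continuous (fun y : Fin n → ℝ => xhat ⬝ᵥ y) := by
        unfold dotProduct
        fun_prop
      let K : Set (Fin n → ℝ) := (LinearMap.range (Matrix.mulVecLin Aᵀ) : Set (Fin n → ℝ)) ∩
        (Set.Iic c ∩ {y | xhat ⬝ᵥ Aᵀ.mulVec p ≤ xhat ⬝ᵥ y})
      have hKcl : IsClosed K :=
        hcl.inter (isClosed_Iic.inter (isClosed_le continuous_const hcont))
      have hKc : IsCompact K := by
        refine (isCompact_Icc (a := fun j => c j - (xhat ⬝ᵥ (c - Aᵀ.mulVec p)) / xhat j)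
          (b := c)).of_isClosed_subset hKcl ?_
        rintro y ⟨-, hy, hy2⟩
        refine ⟨fun j => ?_, hy⟩
        have h3 : xhat j * (c - y) j ≤ xhat ⬝ᵥ (c - y) :=
          Finset.single_le_sum (f := fun i => xhat i * (c - y) i)
            (fun i _ => mul_nonneg (hxhat_pos i).le (sub_nonneg.2 (hy i))) (Finset.mem_univ j)
        have h4 : xhat ⬝ᵥ (c - y) ≤ xhat ⬝ᵥ (c - Aᵀ.mulVec p) := by
          rw [dotProduct_sub, dotProduct_sub]
          exact sub_le_sub_left hy2 _
        have h5 : c j - y j ≤ (xhat ⬝ᵥ (c - Aᵀ.mulVec p)) / xhat j := by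
          rw [le_div_iff₀ (hxhat_pos j), mul_comm]
          exact h3.trans h4
        show c j - (xhat ⬝ᵥ (c - Aᵀ.mulVec p)) / xhat j ≤ y j
        linarith
      have hpK : Aᵀ.mulVec p ∈ K := ⟨⟨p, rfl⟩, hp, le_refl (xhat ⬝ᵥ Aᵀ.mulVec p)⟩
      obtain ⟨y, ⟨⟨π, hπ⟩, hy, hy2⟩, hmax⟩ := hKc.exists_isMaxOn ⟨_, hpK⟩ hcont.continuousOn
      have hπ' : Aᵀ.mulVec π = y := hπ
      refine ⟨π, hπ' ▸ hy, fun q hq => ?_⟩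
      rw [key, key, hπ']
      by_cases h : xhat ⬝ᵥ Aᵀ.mulVec p ≤ xhat ⬝ᵥ Aᵀ.mulVec q
      · exact hmax (show Aᵀ.mulVec q ∈ K from ⟨⟨q, rfl⟩, hq, h⟩)
      · exact (not_le.1 h).le.trans hy2
    refine ⟨π, π, le_antisymm ?_ ?_⟩
    · refine sSup_le ?_
      rintro w ⟨q, hq, rfl⟩
      exact (EReal.coe_le_coe_iff.2 (h2 q hq)).trans (le_sSup ⟨π, h1, le_rfl, le_rfl, rfl⟩)
    · refine sSup_le_sSup ?_
      rintro w ⟨q, hq, -, -, rfl⟩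
      exact ⟨q, hq, rfl⟩
  · refine ⟨0, 0, ?_⟩
    congr 1
    ext w
    constructor
    · rintro ⟨q, hq, -⟩
      exact absurd ⟨q, hq⟩ hne
    · rintro ⟨q, hq, -⟩
      exact absurd ⟨q, hq⟩ hne
end

section
/- Let M be an affine subspace of ℝⁿ and let x̂ ∈ M be a point all of whose components are strictly positive. Then the affine hull of the set M ∩ {x ∈ ℝⁿ : x ≥ 0} is equal to M. -/
/-- If `M` is an affine subspace of `ℝⁿ` containing a point `x̂` with all
components strictly positive, then the affine hull of
`M ∩ {x : x ≥ 0}` equals `M`. -/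
theorem affineSpan_inter_nonneg_eq {n : ℕ}
    (M : AffineSubspace ℝ (Fin n → ℝ))
    (xhat : Fin n → ℝ) (hxhatM : xhat ∈ M) (hxhat_pos : ∀ i, 0 < xhat i) :
    affineSpan ℝ ((M : Set (Fin n → ℝ)) ∩ {x : Fin n → ℝ | 0 ≤ x}) = M := by
  apply le_antisymm
  · exact affineSpan_le.2 Set.inter_subset_left
  · intro y hy
    have h1 : ∀ᶠ t : ℝ in nhds 0, ∀ i, 0 < xhat i + t * (y i - xhat i) := by
      rw [Filter.eventually_all]
      intro i
      have hc : Continuous (fun t : ℝ => xhat i + t * (y i - xhat i)) := by fun_prop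
      exact hc.continuousAt.eventually (lt_mem_nhds (by simpa using hxhat_pos i))
    obtain ⟨t, ht, ht0⟩ := ((h1.filter_mono nhdsWithin_le_nhds).and
      (self_mem_nhdsWithin : Set.Ioi (0 : ℝ) ∈ nhdsWithin 0 (Set.Ioi 0))).exists
    have ht0' : t ≠ 0 := ne_of_gt ht0
    have hx : xhat ∈ affineSpan ℝ ((M : Set (Fin n → ℝ)) ∩ {x : Fin n → ℝ | 0 ≤ x}) :=
      subset_affineSpan ℝ _ ⟨hxhatM, fun i => (hxhat_pos i).le⟩
    have hz : AffineMap.lineMap xhat y t ∈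
        affineSpan ℝ ((M : Set (Fin n → ℝ)) ∩ {x : Fin n → ℝ | 0 ≤ x}) := by
      refine subset_affineSpan ℝ _ ⟨AffineMap.lineMap_mem t hxhatM hy, fun i => ?_⟩
      have := (ht i).le
      simp [AffineMap.lineMap_apply]
      linarith
    have h := AffineMap.lineMap_mem t⁻¹ hx hz
    convert h using 1
    ext i
    simp [AffineMap.lineMap_apply]
    field_simp
    try ring
end

section
/- Let v ∈ ℝⁿ with v ≥ 0 and suppose the box-constrained primal problem minimize c·x subject to Ax = b, 0 ≤ x ≤ v, is feasible. Then the optimal value of the penalized dual problem (D_v) equals the optimal value of this box-constrained primal problem, and both values are finite. -/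
open Matrix

/-- Duality between the penalized dual `max b·π − v·ζ s.t. Aᵀπ ≤ c + ζ, ζ ≥ 0`
and the box-constrained primal `min c·x s.t. Ax = b, 0 ≤ x ≤ v`: if `v ≥ 0`
and the box-constrained primal is feasible, then both problems have the same
finite optimal value. -/
theorem penalized_dual_eq_box_primal {m n : ℕ}
    (A : Matrix (Fin m) (Fin n) ℝ) (b : Fin m → ℝ) (c : Fin n → ℝ)
    (v : Fin n → ℝ) (hv : 0 ≤ v)
    (hfeas : ∃ x : Fin n → ℝ, A.mulVec x = b ∧ 0 ≤ x ∧ x ≤ v) :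
    ∃ w : ℝ,
      IsLUB {w' : ℝ | ∃ π : Fin m → ℝ, ∃ ζ : Fin n → ℝ,
        Aᵀ.mulVec π ≤ c + ζ ∧ 0 ≤ ζ ∧ w' = b ⬝ᵥ π - v ⬝ᵥ ζ} w ∧
      IsGLB {w' : ℝ | ∃ x : Fin n → ℝ,
        A.mulVec x = b ∧ 0 ≤ x ∧ x ≤ v ∧ w' = c ⬝ᵥ x} w := by
  obtain ⟨x0, hx0, hx0n, hx0v⟩ := hfeas
  have hcont : Continuous (fun x : Fin n → ℝ => A.mulVec x) := by fun_prop
  have hcc : Continuous (fun x : Fin n → ℝ => c ⬝ᵥ x) := by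
    simp only [dotProduct]; fun_prop
  have hKc : IsCompact (Set.Icc (0 : Fin n → ℝ) v) := isCompact_Icc
  have hPc : IsCompact (Set.Icc (0 : Fin n → ℝ) v ∩ {x | A.mulVec x = b}) :=
    hKc.inter_right (isClosed_eq hcont continuous_const)
  obtain ⟨xs, ⟨⟨hxs0, hxsv⟩, hxsA⟩, hmin⟩ :=
    hPc.exists_isMinOn ⟨x0, ⟨hx0n, hx0v⟩, hx0⟩ hcc.continuousOn
  have hxsA' : A.mulVec xs = b := hxsA
  have hmin' : ∀ x : Fin n → ℝ, A.mulVec x = b → 0 ≤ x → x ≤ v → c ⬝ᵥ xs ≤ c ⬝ᵥ x :=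
    fun x h1 h2 h3 => hmin ⟨⟨h2, h3⟩, h1⟩
  refine ⟨c ⬝ᵥ xs, ⟨?_, ?_⟩, ⟨?_, ?_⟩⟩
  · rintro w ⟨π, ζ, h1, h2, rfl⟩
    have e1 : b ⬝ᵥ π = Aᵀ.mulVec π ⬝ᵥ xs := by
      rw [← hxsA', Matrix.mulVec_transpose, ← Matrix.dotProduct_mulVec, dotProduct_comm]
    have e2 : Aᵀ.mulVec π ⬝ᵥ xs ≤ (c + ζ) ⬝ᵥ xs :=
      dotProduct_le_dotProduct_of_nonneg_right h1 hxs0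
    have e3 : ζ ⬝ᵥ xs ≤ ζ ⬝ᵥ v := dotProduct_le_dotProduct_of_nonneg_left hxsv h2
    rw [add_dotProduct] at e2
    rw [dotProduct_comm v ζ]
    linarith
  · intro w hw
    by_contra! hlt
    let S : Set ((Fin m → ℝ) × ℝ) :=
      (fun x : Fin n → ℝ => (A.mulVec x, c ⬝ᵥ x)) '' Set.Icc (0 : Fin n → ℝ) v
    have hSc : IsCompact S := hKc.image (hcont.prodMk hcc)
    have hSconv : Convex ℝ S := by
      have hl : IsLinearMap ℝ (fun x : Fin n → ℝ => (A.mulVec x, c ⬝ᵥ x)) := by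
        constructor
        · intro x y
          simp [Matrix.mulVec_add, dotProduct_add]
        · intro r x
          simp [Matrix.mulVec_smul, dotProduct_smul]
      exact (convex_Icc _ _).is_linear_image hl
    have hnot : ((b, w) : (Fin m → ℝ) × ℝ) ∉ S := by
      rintro ⟨x, ⟨h2, h3⟩, hx⟩
      simp only [Prod.mk.injEq] at hx
      have := hmin' x hx.1 h2 h3
      linarith [hx.2]
    obtain ⟨f, u, hfu, hS⟩ := geometric_hahn_banach_point_closed hSconv hSc.isClosed hnot
    set β : ℝ := f (0, 1) with hβ
    set φ : Fin m → ℝ := fun i => f (Pi.single i 1, 0) with hφ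
    have hf : ∀ (y : Fin m → ℝ) (t : ℝ), f (y, t) = φ ⬝ᵥ y + β * t := by
      intro y t
      have e : ((y, t) : (Fin m → ℝ) × ℝ)
          = (∑ i, y i • ((Pi.single i 1, 0) : (Fin m → ℝ) × ℝ)) + t • (0, 1) := by
        ext j
        · simp [Prod.fst_sum, Finset.sum_apply, Pi.single_apply]
        · simp [Prod.snd_sum]
      rw [e, map_add, map_sum, map_smul]
      simp only [map_smul, smul_eq_mul, dotProduct, hφ, hβ]
      congr 1
      · exact Finset.sum_congr rfl fun i _ => mul_comm _ _
      · exact mul_comm _ _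
    have hxx := hS (A.mulVec xs, c ⬝ᵥ xs) ⟨xs, ⟨hxs0, hxsv⟩, rfl⟩
    rw [hf] at hfu
    rw [hf, hxsA'] at hxx
    have hβpos : 0 < β := by
      by_contra! h
      nlinarith
    let π : Fin m → ℝ := (-β⁻¹) • φ
    have hπ : φ = (-β) • π := by
      simp only [π, smul_smul]
      rw [neg_mul_neg, mul_inv_cancel₀ hβpos.ne', one_smul]
    let d : Fin n → ℝ := Aᵀ.mulVec π - c
    let ζ : Fin n → ℝ := fun j => max (d j) 0
    let x : Fin n → ℝ := fun j => if 0 < d j then v j else 0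
    have hx0' : 0 ≤ x := by
      intro j
      have := hv j
      simp only [x]
      split_ifs
      · exact this
      · exact le_rfl
    have hxv' : x ≤ v := by
      intro j
      have := hv j
      simp only [x]
      split_ifs
      · exact le_rfl
      · exact this
    have hxS := hS (A.mulVec x, c ⬝ᵥ x) ⟨x, ⟨hx0', hxv'⟩, rfl⟩
    rw [hf] at hxS
    have hdual := hw ⟨π, ζ, (by
      intro j
      have : d j ≤ ζ j := le_max_left _ _
      simp only [d, Pi.sub_apply] at this
      simp only [Pi.add_apply]
      linarith), (fun j => le_max_right _ _), rfl⟩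
    have hvz : v ⬝ᵥ ζ = d ⬝ᵥ x := by
      simp only [dotProduct]
      refine Finset.sum_congr rfl fun j _ => ?_
      simp only [ζ, x]
      split_ifs with h
      · rw [max_eq_left h.le, mul_comm]
      · rw [max_eq_right (not_lt.mp h)]; simp
    have hdx : d ⬝ᵥ x = π ⬝ᵥ A.mulVec x - c ⬝ᵥ x := by
      simp only [d]
      rw [sub_dotProduct, Matrix.mulVec_transpose, ← Matrix.dotProduct_mulVec]
    rw [hπ, smul_dotProduct, smul_eq_mul] at hxS hfu
    rw [hvz, hdx, dotProduct_comm b π] at hdual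
    have := mul_le_mul_of_nonneg_left hdual hβpos.le
    nlinarith
  · rintro w ⟨x, h1, h2, h3, rfl⟩
    exact hmin' x h1 h2 h3
  · intro w hw
    exact hw ⟨xs, hxsA', hxs0, hxsv, rfl⟩
end
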